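/- Let r₁, r₂, m be integers with 0 < r₁ < r₂ < m and r₁ even. Then there exist two sets C, D ⊆ ℕ with C ∪ D = ℕ and C ∩ D = (r₁ + mℕ) ∪ (r₂ + mℕ) such that R_C(n) = R_D(n) for all n ∈ ℕ if and only if there exists a positive integer l such that r₁ = 2^(2l+1) − 2, r₂ = 2^(2l+1) − 1, and m = 2^(2l+2) − 2. -/

import Mathlib

/-- `R S n` is the number of pairs `(s, s')` with `s, s' ∈ S`, `s < s'` and `s + s' = n`. -/
noncomputable def R (S : Set ℕ) (n : ℕ) : ℕ :=
  Set.ncard {p : ℕ × ℕ | p.1 ∈ S ∧ p.2 ∈ S ∧ p.1 < p.2 ∧ p.1 + p.2 = n}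

/-- `AP r m` is the arithmetic progression `r + mℕ = {r + m*k : k ∈ ℕ}`. -/
def AP (r m : ℕ) : Set ℕ := {n | ∃ k : ℕ, n = r + m * k}

/-- The Thue–Morse sequence with values `±1`. -/
def thueMorse : ℕ → ℤ
  | 0 => 1
  | n + 1 => if (n + 1) % 2 = 0 then thueMorse ((n + 1) / 2) else -thueMorse ((n + 1) / 2)

theorem thueMorse_zero : thueMorse 0 = 1 := by rw [thueMorse]

theorem thueMorse_two_mul (n : ℕ) : thueMorse (2 * n) = thueMorse n := by
  rcases n with _ | n
  · rfl
  · rw [show 2 * (n + 1) = (2 * n + 1) + 1 by ring, thueMorse, if_pos (by omega)]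
    congr 1
    omega

theorem thueMorse_two_mul_add_one (n : ℕ) : thueMorse (2 * n + 1) = -thueMorse n := by
  rw [thueMorse, if_neg (by omega)]
  congr 2
  omega

theorem thueMorse_one : thueMorse 1 = -1 := by
  simpa [thueMorse_zero] using thueMorse_two_mul_add_one 0

theorem thueMorse_two : thueMorse 2 = -1 := by
  simpa [thueMorse_one] using thueMorse_two_mul 1

theorem thueMorse_eq_one_or (n : ℕ) : thueMorse n = 1 ∨ thueMorse n = -1 := by
  induction n using Nat.strong_induction_on with
  | _ n ih =>
    rcases n with _ | n
    · exact Or.inl thueMorse_zero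
    · rw [thueMorse]
      rcases ih ((n + 1) / 2) (by omega) with h | h <;> split_ifs <;> simp [h]

theorem thueMorse_add_one_of_even {n : ℕ} (hn : Even n) :
    thueMorse (n + 1) = -thueMorse n := by
  obtain ⟨k, rfl⟩ := hn
  rw [← two_mul, thueMorse_two_mul_add_one, thueMorse_two_mul]

theorem thueMorse_two_pow_mul_add (k q : ℕ) {i : ℕ} (hi : i < 2 ^ k) :
    thueMorse (2 ^ k * q + i) = thueMorse q * thueMorse i := by
  induction k generalizing i with
  | zero =>
    obtain rfl : i = 0 := by simpa using hi
    simp [thueMorse_zero]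
  | succ k ih =>
    have hp : 2 ^ (k + 1) = 2 * 2 ^ k := by ring
    rcases Nat.even_or_odd' i with ⟨j, rfl | rfl⟩
    · rw [show 2 ^ (k + 1) * q + 2 * j = 2 * (2 ^ k * q + j) by rw [hp]; ring,
        thueMorse_two_mul, thueMorse_two_mul, ih (by omega)]
    · rw [show 2 ^ (k + 1) * q + (2 * j + 1) = 2 * (2 ^ k * q + j) + 1 by rw [hp]; ring,
        thueMorse_two_mul_add_one, thueMorse_two_mul_add_one, ih (by omega)]
      ring

theorem thueMorse_two_pow_mul (k q : ℕ) : thueMorse (2 ^ k * q) = thueMorse q := by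
  simpa [thueMorse_zero] using thueMorse_two_pow_mul_add k q (i := 0) (by positivity)

theorem thueMorse_two_pow (k : ℕ) : thueMorse (2 ^ k) = -1 := by
  simpa [thueMorse_one] using thueMorse_two_pow_mul k 1

theorem thueMorse_two_pow_add {k i : ℕ} (hi : i < 2 ^ k) :
    thueMorse (2 ^ k + i) = -thueMorse i := by
  simpa [thueMorse_one] using thueMorse_two_pow_mul_add k 1 hi

theorem thueMorse_two_pow_sub_one (k : ℕ) : thueMorse (2 ^ k - 1) = (-1) ^ k := by
  induction k with
  | zero => simp [thueMorse_zero]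
  | succ k ih =>
    have := Nat.one_le_two_pow (n := k)
    rw [show 2 ^ (k + 1) - 1 = 2 * (2 ^ k - 1) + 1 by rw [pow_succ]; omega,
      thueMorse_two_mul_add_one, ih, pow_succ]
    ring

/-- The translate of the Thue–Morse sequence by an even `r` of value `1` agrees with the sequence
itself exactly on an initial segment whose length is a power of two. -/
theorem exists_thueMorse_agreement {r : ℕ} (hr : Even r) (hr0 : 0 < r) (her : thueMorse r = 1) :
    ∃ c : ℕ, (∀ i < 2 ^ (c + 1), thueMorse (r + i) = thueMorse i) ∧
      (∀ i < 2 ^ c, thueMorse (r + 2 ^ (c + 1) + i) = thueMorse i) ∧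
      (r = 3 * 2 ^ c ∨ 2 ^ (c + 2) + 1 < r) := by
  obtain ⟨a, p, hp, rfl⟩ := Nat.exists_eq_two_pow_mul_odd hr0.ne'
  have ha : a ≠ 0 := by
    rintro rfl
    rw [pow_zero, one_mul] at hr
    exact (Nat.not_even_iff_odd.mpr hp) hr
  obtain ⟨b, rfl⟩ := Nat.exists_eq_succ_of_ne_zero ha
  rw [Nat.succ_eq_add_one] at *
  rw [thueMorse_two_pow_mul] at her
  have hp1 : p ≠ 1 := by
    rintro rfl
    norm_num [thueMorse_one] at her
  have hp3 : 3 ≤ p := by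
    obtain ⟨k, rfl⟩ := hp
    omega
  have hb := Nat.one_le_two_pow (n := b)
  have e1 : 2 ^ (b + 1) = 2 * 2 ^ b := by ring
  have e2 : 2 ^ (b + 2) = 4 * 2 ^ b := by ring
  have e3 : 2 ^ (b + 1 + 2) = 8 * 2 ^ b := by ring
  rcases thueMorse_eq_one_or (p + 1) with h | h
  · refine ⟨b, fun i hi => ?_, fun i hi => ?_, Or.inr ?_⟩
    · rw [thueMorse_two_pow_mul_add _ _ hi, her, one_mul]
    · rw [show 2 ^ (b + 1) * p + 2 ^ (b + 1) + i = 2 ^ (b + 1) * (p + 1) + i by ring,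
        thueMorse_two_pow_mul_add _ _ (by omega), h, one_mul]
    · nlinarith
  · refine ⟨b + 1, fun i hi => ?_, fun i hi => ?_, ?_⟩
    · rcases lt_or_ge i (2 ^ (b + 1)) with hi' | hi'
      · rw [thueMorse_two_pow_mul_add _ _ hi', her, one_mul]
      · obtain ⟨j, rfl⟩ := Nat.exists_eq_add_of_le hi'
        have hj : j < 2 ^ (b + 1) := by rw [pow_succ] at hi; omega
        rw [show 2 ^ (b + 1) * p + (2 ^ (b + 1) + j) = 2 ^ (b + 1) * (p + 1) + j by ring,
          thueMorse_two_pow_mul_add _ _ hj, h, thueMorse_two_pow_add hj]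
        ring
    · have h2 : thueMorse (p + 2) = 1 := by
        rw [show p + 2 = p + 1 + 1 by ring, thueMorse_add_one_of_even (hp.add_one), h, neg_neg]
      rw [show 2 ^ (b + 1) * p + 2 ^ (b + 1 + 1) + i = 2 ^ (b + 1) * (p + 2) + i by ring,
        thueMorse_two_pow_mul_add _ _ hi, h2, one_mul]
    · rcases eq_or_ne p 3 with rfl | h3
      · left; ring
      · right
        have : 5 ≤ p := by
          obtain ⟨k, rfl⟩ := hp
          omega
        nlinarith

/-- `delay t k` is the sequence `t` shifted to the right by `k` places. -/
def delay (t : ℕ → ℤ) (k n : ℕ) : ℤ := if k ≤ n then t (n - k) else 0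

theorem delay_of_lt (t : ℕ → ℤ) {k n : ℕ} (h : n < k) : delay t k n = 0 :=
  if_neg (by omega)

theorem delay_add (t : ℕ → ℤ) (k n : ℕ) : delay t k (k + n) = t n := by
  simp [delay]

/-- The relations satisfied below `2 * r + d + 1` by the difference of the indicator functions of
two sets with equal representation functions that cover `ℕ` and overlap in
`AP r (2 * r + d + 1) ∪ AP (r + d) (2 * r + d + 1)`. -/
structure IsInitialSolution (r d : ℕ) (t : ℕ → ℤ) : Prop where
  zero : t 0 = 1
  le_one : ∀ n, t n ≤ 1
  neg_one_le : ∀ n, -1 ≤ t n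
  left : t r = 0
  right : t (r + d) = 0
  recurrence : ∀ n < 2 * r + d + 1, t n = (-1) ^ n * t (n / 2) - delay t r n
    + delay t (r + 1) n - delay t (r + d) n + delay t (r + d + 1) n

theorem thueMorse_eq_sign_mul (n : ℕ) : thueMorse n = (-1) ^ n * thueMorse (n / 2) := by
  rcases Nat.even_or_odd' n with ⟨k, rfl | rfl⟩
  · rw [thueMorse_two_mul, Even.neg_one_pow (by simp), one_mul]
    congr 1
    omega
  · rw [thueMorse_two_mul_add_one, Odd.neg_one_pow (by simp), neg_one_mul]
    congr 2
    omega

namespace IsInitialSolution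

variable {r d : ℕ} {t : ℕ → ℤ}

theorem eq_thueMorse (h : IsInitialSolution r d t) {n : ℕ} (hn : n < r) : t n = thueMorse n := by
  induction n using Nat.strong_induction_on with
  | _ n ih =>
    rcases Nat.eq_zero_or_pos n with rfl | h0
    · rw [h.zero, thueMorse_zero]
    · rw [h.recurrence n (by omega), delay_of_lt, delay_of_lt, delay_of_lt, delay_of_lt,
        ih (n / 2) (by omega) (by omega), thueMorse_eq_sign_mul n] <;> omega

theorem sign_mul_eq (h : IsInitialSolution r d t) {n : ℕ} (hn : n < 2 * r) :
    (-1) ^ n * t (n / 2) = thueMorse n := by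
  rw [h.eq_thueMorse (by omega), thueMorse_eq_sign_mul n]

theorem thueMorse_left (h : IsInitialSolution r d t) (hr : 0 < r) (hd : 0 < d) :
    thueMorse r = 1 := by
  have := h.recurrence r (by omega)
  rw [h.left, h.sign_mul_eq (by omega), delay_of_lt _ (by omega : r < r + 1),
    delay_of_lt _ (by omega : r < r + d), delay_of_lt _ (by omega : r < r + d + 1)] at this
  have e := delay_add t r 0
  rw [add_zero, h.zero] at e
  linarith

theorem between (h : IsInitialSolution r d t) {j : ℕ} (hj : j + 1 < d) :
    t (r + 1 + j) = (-1) ^ (r + 1 + j) * t ((r + 1 + j) / 2) - t (1 + j) + t j := by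
  rw [h.recurrence _ (by omega), delay_add, delay_of_lt _ (by omega : r + 1 + j < r + d),
    delay_of_lt _ (by omega : r + 1 + j < r + d + 1), add_assoc r 1 j, delay_add]
  ring

theorem between_eq (h : IsInitialSolution r d t) {j : ℕ} (hj : j + 1 < d) (hjr : j + 1 < r) :
    t (r + 1 + j) = thueMorse (r + 1 + j) - thueMorse (1 + j) + thueMorse j := by
  rw [h.between hj, h.sign_mul_eq (by omega), h.eq_thueMorse (by omega), h.eq_thueMorse (by omega)]

theorem thueMorse_right (h : IsInitialSolution r d t) (hd : 0 < d) (hdr : d < r) :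
    thueMorse (r + d) = thueMorse d - thueMorse (d - 1) + 1 := by
  have := h.recurrence (r + d) (by omega)
  have e := delay_add t (r + d) 0
  have e' := delay_add t (r + 1) (d - 1)
  rw [show r + 1 + (d - 1) = r + d by omega] at e'
  rw [h.right, h.sign_mul_eq (by omega), delay_add, e', delay_of_lt _ (by omega : r + d < r + d + 1),
    h.eq_thueMorse hdr, h.eq_thueMorse (by omega)] at this
  rw [add_zero, h.zero] at e
  linarith

theorem after (h : IsInitialSolution r d t) {j : ℕ} (hj : j < r) :
    t (r + d + 1 + j) = (-1) ^ (r + d + 1 + j) * t ((r + d + 1 + j) / 2)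
      - t (d + 1 + j) + t (d + j) - t (1 + j) + t j := by
  have e1 := delay_add t r (d + 1 + j)
  have e2 := delay_add t (r + 1) (d + j)
  have e3 := delay_add t (r + d) (1 + j)
  have e4 := delay_add t (r + d + 1) j
  rw [show r + (d + 1 + j) = r + d + 1 + j by ring] at e1
  rw [show r + 1 + (d + j) = r + d + 1 + j by ring] at e2
  rw [show r + d + (1 + j) = r + d + 1 + j by ring] at e3
  rw [h.recurrence _ (by omega), e1, e2, e3, e4]

theorem after_eq (h : IsInitialSolution r d t) {j : ℕ} (hj : d + 1 + j < r) :
    t (r + d + 1 + j) = thueMorse (r + d + 1 + j) - thueMorse (d + 1 + j) + thueMorse (d + j)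
      - thueMorse (1 + j) + thueMorse j := by
  rw [h.after (by omega), h.sign_mul_eq (by omega), h.eq_thueMorse hj, h.eq_thueMorse (by omega),
    h.eq_thueMorse (by omega), h.eq_thueMorse (by omega)]

theorem six_le (h : IsInitialSolution r d t) (hr : 0 < r) (he : Even r) (hd : 0 < d) : 6 ≤ r := by
  by_contra! hlt
  have h2 := thueMorse_two
  have h4 : thueMorse 4 = -1 := thueMorse_two_pow 2
  have := h.thueMorse_left hr hd
  interval_cases r <;> first | omega | (exact absurd he (by decide))

/-- The gap is at most the length of the agreement of the Thue–Morse sequence with its translate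
by `r`. -/
theorem gap_le (h : IsInitialSolution r d t) (hr : 6 ≤ r) {c : ℕ}
    (hodd : thueMorse (r + 2 ^ (c + 1) + 1) = -1)
    (hcr : 3 * 2 ^ c ≤ r) : d ≤ 2 ^ (c + 1) := by
  by_contra! hlt
  have hp : 2 ^ (c + 1) = 2 * 2 ^ c := by ring
  have h1 := thueMorse_two_pow (c + 1)
  have h2 : thueMorse (2 ^ (c + 1) + 1) = 1 := by
    rw [thueMorse_add_one_of_even ⟨2 ^ c, by omega⟩, h1, neg_neg]
  have hlt' : 2 ^ (c + 1) + 1 < r := by omega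
  rcases eq_or_ne d (2 ^ (c + 1) + 1) with heq | hne
  · have := h.thueMorse_right (by omega) (by omega)
    rw [heq, ← add_assoc, hodd, h2, Nat.add_sub_cancel, h1] at this
    omega
  · have := h.between_eq (j := 2 ^ (c + 1)) (by omega) hlt'
    rw [show r + 1 + 2 ^ (c + 1) = r + 2 ^ (c + 1) + 1 by ring, hodd, add_comm 1, h2, h1] at this
    have := h.neg_one_le (r + 2 ^ (c + 1) + 1)
    omega

theorem gap_ne_of_eq (h : IsInitialSolution r d t) {c : ℕ} (hd : d = 2 ^ (c + 1))
    (hr6 : 6 ≤ r) (hr : r = 3 * 2 ^ c) : False := by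
  have hp : 2 ^ (c + 1) = 2 * 2 ^ c := by ring
  have h1 := thueMorse_two_pow c
  have hc : 1 ≤ c := by
    rcases c with _ | c
    · omega
    · omega
  have h2 : thueMorse (2 ^ c + 1) = 1 := by
    rw [thueMorse_add_one_of_even ((Nat.even_pow.mpr ⟨even_two, by omega⟩)), h1, neg_neg]
  have hr1 := h.between (j := 0) (by omega)
  have ha := h.after (j := 2 ^ c) (by omega)
  have e1 : (r + d + 1 + 2 ^ c) / 2 = r := by omega
  have e2 : d + 1 + 2 ^ c = r + 1 + 0 := by omega
  have e3 : d + 2 ^ c = r := by omega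
  have her : thueMorse (r + 1) = -1 := by
    rw [thueMorse_add_one_of_even, h.thueMorse_left (by omega) (by omega)]
    rw [hr, Nat.even_mul]
    exact Or.inr (Nat.even_pow.mpr ⟨even_two, by omega⟩)
  have hs := h.sign_mul_eq (n := r + 1) (by omega)
  rw [e1, e2, e3, h.left, add_comm 1, h.eq_thueMorse (n := 2 ^ c + 1) (by omega),
    h.eq_thueMorse (n := 2 ^ c) (by omega), h1, h2] at ha
  rw [add_zero, hs, her, add_zero, h.zero, h.eq_thueMorse (n := 1) (by omega),
    thueMorse_one] at hr1
  have := h.neg_one_le (r + d + 1 + 2 ^ c)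
  simp only [add_zero] at ha
  omega

theorem gap_ne_of_lt (h : IsInitialSolution r d t) {c : ℕ} (hd : d = 2 ^ (c + 1))
    (hr : 2 ^ (c + 2) + 1 < r) : False := by
  have hp : 2 ^ (c + 1) = 2 * 2 ^ c := by ring
  have hp2 : 2 ^ (c + 2) = 4 * 2 ^ c := by ring
  have h1 := thueMorse_two_pow (c + 1)
  have h2 : thueMorse (2 ^ (c + 1) + 1) = 1 := by
    rw [thueMorse_add_one_of_even ⟨2 ^ c, by omega⟩, h1, neg_neg]
  have h3 := thueMorse_two_pow (c + 2)
  have h4 : thueMorse (2 ^ (c + 2) + 1) = 1 := by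
    rw [thueMorse_add_one_of_even ⟨2 ^ (c + 1), by omega⟩, h3, neg_neg]
  have ha := h.after_eq (j := d) (by omega)
  rw [show d + 1 + d = 2 ^ (c + 2) + 1 by omega, show d + d = 2 ^ (c + 2) by omega, add_comm 1,
    hd, h1, h2, h3, h4] at ha
  have := h.neg_one_le (r + 2 ^ (c + 1) + 1 + 2 ^ (c + 1))
  rcases thueMorse_eq_one_or (r + 2 ^ (c + 1) + 1 + 2 ^ (c + 1)) with h5 | h5 <;> omega

theorem gap_ge (h : IsInitialSolution r d t) (hr6 : 6 ≤ r) (hd : 2 ≤ d) {c : ℕ}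
    (hagree : ∀ i < 2 ^ (c + 1), thueMorse (r + i) = thueMorse i)
    (hagree' : ∀ i < 2 ^ c, thueMorse (r + 2 ^ (c + 1) + i) = thueMorse i)
    (hcr : 3 * 2 ^ c ≤ r) : 2 ^ (c + 1) ≤ d := by
  by_contra! hlt
  have hp : 2 ^ (c + 1) = 2 * 2 ^ c := by ring
  have hpos := Nat.one_le_two_pow (n := c)
  have hB := thueMorse_two_pow (c + 1)
  have hd1 : thueMorse (d - 1) = 1 := by
    have := h.thueMorse_right (by omega) (by omega)
    rw [hagree d hlt] at this
    linarith
  have hd0 : thueMorse d = -1 := by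
    have := h.after_eq (j := 0) (by omega)
    have hle := h.le_one (r + d + 1 + 0)
    simp only [add_zero, thueMorse_one, thueMorse_zero] at this hle
    rcases eq_or_ne (d + 1) (2 ^ (c + 1)) with heq | hne
    · have h0 := hagree' 0 (by omega)
      rw [add_zero, thueMorse_zero] at h0
      rw [add_assoc, heq, h0, hB] at this
      rw [add_assoc, heq] at hle
      rcases thueMorse_eq_one_or d with h1 | h1 <;> omega
    · rw [add_assoc, hagree (d + 1) (by omega)] at this
      rw [add_assoc] at hle
      rcases thueMorse_eq_one_or d with h1 | h1 <;> omega
  have hd4 : 4 ≤ d := by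
    by_contra! hlt4
    have h1 := thueMorse_one
    have h2 := thueMorse_two
    interval_cases d <;> simp_all
  have hc2 : 4 ≤ 2 ^ c := by
    have : 2 ≤ c := by
      by_contra! hlt2
      interval_cases c <;> omega
    calc 4 = 2 ^ 2 := by norm_num
      _ ≤ 2 ^ c := Nat.pow_le_pow_right (by norm_num) this
  have hB1 : thueMorse (2 ^ (c + 1) + 1) = 1 := by
    rw [thueMorse_two_pow_add (by omega), thueMorse_one, neg_neg]
  have hB2 : thueMorse (2 ^ (c + 1) + 2) = 1 := by
    rw [thueMorse_two_pow_add (by omega), thueMorse_two, neg_neg]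
  obtain ⟨w, hw⟩ : ∃ w, d + w = 2 ^ (c + 1) := ⟨2 ^ (c + 1) - d, by omega⟩
  have hw1 : thueMorse w = 1 ∧ thueMorse (w + 1) = -1 := by
    have := h.after_eq (j := w) (by omega)
    have hge := h.neg_one_le (r + d + 1 + w)
    have h1 := hagree' 1 (by omega)
    rw [thueMorse_one] at h1
    rw [this, show r + d + 1 + w = r + 2 ^ (c + 1) + 1 by omega, h1,
      show d + 1 + w = 2 ^ (c + 1) + 1 by omega, hB1, hw, hB, add_comm 1] at hge
    rcases thueMorse_eq_one_or w with h2 | h2 <;>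
      rcases thueMorse_eq_one_or (w + 1) with h3 | h3 <;> omega
  have hw2 : thueMorse (w + 1 + 1) = -1 := by
    have := h.after_eq (j := w + 1) (by omega)
    have hge := h.neg_one_le (r + d + 1 + (w + 1))
    have h1 := hagree' 2 (by omega)
    rw [thueMorse_two] at h1
    rw [this, show r + d + 1 + (w + 1) = r + 2 ^ (c + 1) + 2 by omega, h1,
      show d + 1 + (w + 1) = 2 ^ (c + 1) + 2 by omega, hB2,
      show d + (w + 1) = 2 ^ (c + 1) + 1 by omega, hB1, hw1.2, add_comm 1] at hge
    rcases thueMorse_eq_one_or (w + 1 + 1) with h3 | h3 <;> omega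
  have hweven : Even w := by
    by_contra hodd
    have := thueMorse_add_one_of_even (Nat.not_even_iff_odd.mp hodd).add_one
    rw [hw2, hw1.2] at this
    norm_num at this
  obtain ⟨f, o, ho, hfo⟩ := Nat.exists_eq_two_pow_mul_odd (show w ≠ 0 by omega)
  have hf : f ≠ 0 := by
    rintro rfl
    rw [pow_zero, one_mul] at hfo
    exact Nat.not_even_iff_odd.mpr (hfo ▸ ho) hweven
  have ho3 : 3 ≤ o := by
    obtain ⟨k, rfl⟩ := ho
    rcases k with _ | k
    · have := thueMorse_two_pow f
      simp only [mul_zero, zero_add, mul_one] at hfo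
      rw [← hfo, hw1.1] at this
      norm_num at this
    · omega
  have hf2 : 2 ≤ 2 ^ f := Nat.le_self_pow hf 2
  have hfw : 3 * 2 ^ f ≤ w := by nlinarith
  have hfc : f < c + 1 := (Nat.pow_lt_pow_iff_right (by norm_num : 1 < 2)).mp (by omega)
  obtain ⟨p, hp1, hpd⟩ : ∃ p, Odd p ∧ d = 2 ^ f * p := by
    obtain ⟨g, rfl⟩ := Nat.exists_eq_add_of_le (Nat.lt_succ_iff.mp hfc)
    have hog : o ≤ 2 ^ (g + 1) := by
      refine Nat.le_of_mul_le_mul_left (c := 2 ^ f) ?_ (by positivity)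
      rw [← hfo, ← pow_add, ← add_assoc]
      omega
    refine ⟨2 ^ (g + 1) - o, Nat.Even.sub_odd hog ?_ ho, ?_⟩
    · exact Nat.even_pow.mpr ⟨even_two, by omega⟩
    · rw [Nat.mul_sub, ← hfo, ← pow_add, ← add_assoc]
      omega
  have key : ∀ k, 1 ≤ k → k ≤ 2 → thueMorse k = -1 → thueMorse (p + k) = 1 := by
    intro k hk1 hk2 hk
    have hj : 2 ^ f * k ≤ 2 * 2 ^ f := by nlinarith
    have hlt' : d + 1 + 2 ^ f * k < 2 ^ (c + 1) := by omega
    have := h.after_eq (j := 2 ^ f * k) (by omega)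
    have hge := h.neg_one_le (r + d + 1 + 2 ^ f * k)
    have heven : Even (2 ^ f * k) := by
      rw [Nat.even_mul]
      exact Or.inl (Nat.even_pow.mpr ⟨even_two, hf⟩)
    rw [this, show r + d + 1 + 2 ^ f * k = r + (d + 1 + 2 ^ f * k) by ring, hagree _ hlt',
      add_comm 1, thueMorse_add_one_of_even heven, thueMorse_two_pow_mul, hk,
      show d + 2 ^ f * k = 2 ^ f * (p + k) by rw [hpd]; ring, thueMorse_two_pow_mul] at hge
    rcases thueMorse_eq_one_or (p + k) with h3 | h3 <;> omega
  have k1 := key 1 le_rfl (by norm_num) thueMorse_one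
  have k2 := key 2 (by norm_num) le_rfl thueMorse_two
  have := thueMorse_add_one_of_even hp1.add_one
  rw [add_assoc, k2, k1] at this
  norm_num at this

theorem gap_eq_one (h : IsInitialSolution r d t) (hr : 0 < r) (he : Even r) (hd : 0 < d) :
    d = 1 := by
  by_contra hd1
  have hr6 := h.six_le hr he hd
  obtain ⟨c, hagree, hagree', hcr⟩ := exists_thueMorse_agreement he hr (h.thueMorse_left hr hd)
  have hp : 2 ^ (c + 1) = 2 * 2 ^ c := by ring
  have hp2 : 2 ^ (c + 2) = 4 * 2 ^ c := by ring
  have hcr' : 3 * 2 ^ c ≤ r := by omega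
  have h1 : thueMorse (r + 2 ^ (c + 1) + 1) = -1 := by
    rw [thueMorse_add_one_of_even (he.add ⟨2 ^ c, by omega⟩), ← add_zero (r + _),
      hagree' 0 (by positivity), thueMorse_zero]
  have heq : d = 2 ^ (c + 1) :=
    le_antisymm (h.gap_le hr6 h1 hcr') (h.gap_ge hr6 (by omega) hagree hagree' hcr')
  rcases hcr with hcr | hcr
  · exact h.gap_ne_of_eq heq hr6 hcr
  · exact h.gap_ne_of_lt heq hcr

theorem exists_two_pow (h : IsInitialSolution r 1 t) (hr : 0 < r) (he : Even r) :
    ∃ l, 0 < l ∧ r = 2 ^ (2 * l + 1) - 2 := by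
  have hr6 := h.six_le hr he one_pos
  obtain ⟨k, rfl⟩ := he.two_dvd
  have hk : thueMorse k = 1 := by
    rw [← thueMorse_two_mul, h.thueMorse_left hr one_pos]
  have bound : ∀ i, i + 1 < k →
      t (2 * (k + 1 + i)) = thueMorse (k + 1 + i) - thueMorse (1 + i) + thueMorse i := by
    intro i hi
    have := h.after (j := 2 * i) (by omega)
    rw [show 2 * k + 1 + 1 + 2 * i = 2 * (k + 1 + i) by ring, h.eq_thueMorse (n := 2 * i) (by omega),
      h.eq_thueMorse (n := 1 + 2 * i) (by omega),
      h.eq_thueMorse (n := 1 + 1 + 2 * i) (by omega)] at this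
    rw [this, Nat.mul_div_cancel_left _ two_pos, Even.neg_one_pow (by simp), one_mul,
      h.eq_thueMorse (by omega), show 1 + 1 + 2 * i = 2 * (1 + i) by ring, thueMorse_two_mul,
      thueMorse_two_mul]
    ring
  have hs : thueMorse (k + 1) = -1 := by
    have := bound 0 (by omega)
    have hle := h.le_one (2 * (k + 1 + 0))
    rw [this] at hle
    simp only [add_zero, thueMorse_one, thueMorse_zero] at hle
    rcases thueMorse_eq_one_or (k + 1) with h1 | h1 <;> omega
  obtain ⟨c, hc1, hc2⟩ : ∃ c, 2 ^ c ≤ k + 1 ∧ k + 1 < 2 ^ (c + 1) :=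
    ⟨Nat.log 2 (k + 1), Nat.pow_log_le_self 2 (by omega), Nat.lt_pow_succ_log_self (by norm_num) _⟩
  obtain ⟨v, hv⟩ := Nat.exists_eq_add_of_le hc1
  have hvlt : v < 2 ^ c := by rw [pow_succ] at hc2; omega
  have hev : thueMorse v = 1 := by
    rw [hv, thueMorse_two_pow_add hvlt] at hs
    linarith
  have hv0 : v = 0 := by
    by_contra hv0
    have hv3 : 3 ≤ v := by
      by_contra! hlt
      interval_cases v
      · exact hv0 rfl
      · rw [thueMorse_one] at hev
        norm_num at hev
      · rw [thueMorse_two] at hev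
        norm_num at hev
    have := bound (2 ^ c) (by omega)
    have hge := h.neg_one_le (2 * (k + 1 + 2 ^ c))
    rw [this, show k + 1 + 2 ^ c = 2 ^ (c + 1) + v by rw [pow_succ]; omega,
      thueMorse_two_pow_add (by rw [pow_succ]; omega), hev, add_comm 1,
      thueMorse_two_pow_add (by omega), thueMorse_one, thueMorse_two_pow] at hge
    norm_num at hge
  have hkc : k = 2 ^ c - 1 := by omega
  rw [hkc, thueMorse_two_pow_sub_one] at hk
  have hceven : Even c := by
    by_contra hodd
    rw [Odd.neg_one_pow (Nat.not_even_iff_odd.mp hodd)] at hk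
    norm_num at hk
  obtain ⟨l, rfl⟩ := hceven.two_dvd
  refine ⟨l, ?_, ?_⟩
  · rcases l with _ | l
    · simp at hkc
      omega
    · omega
  · rw [hkc, pow_succ]
    omega

end IsInitialSolution

/-- The generating function of a set of natural numbers. -/
noncomputable def indSeries (S : Set ℕ) : PowerSeries ℤ := PowerSeries.mk (S.indicator 1)

theorem coeff_indSeries (S : Set ℕ) (n : ℕ) :
    PowerSeries.coeff n (indSeries S) = S.indicator 1 n := PowerSeries.coeff_mk _ _

theorem coeff_indSeries_sq (S : Set ℕ) (n : ℕ) :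
    PowerSeries.coeff n (indSeries S ^ 2) =
      2 * R S n + PowerSeries.coeff n (PowerSeries.expand 2 two_ne_zero (indSeries S)) := by
  classical
  set A := Finset.HasAntidiagonal.antidiagonal n with hA
  set f : ℕ × ℕ → ℤ := fun p => S.indicator 1 p.1 * S.indicator 1 p.2 with hf
  have hlt : ∑ p ∈ A with p.1 < p.2, f p = R S n := by
    have hR : R S n = (A.filter fun p => p.1 < p.2 ∧ p.1 ∈ S ∧ p.2 ∈ S).card := by
      rw [R, ← Set.ncard_coe_finset]
      congr 1
      ext p
      simp [hA]
      tauto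
    rw [hR, ← Finset.filter_filter, Finset.card_filter]
    push_cast
    refine Finset.sum_congr rfl fun p _ => ?_
    by_cases h1 : p.1 ∈ S <;> by_cases h2 : p.2 ∈ S <;> simp [hf, h1, h2]
  have hgt : ∑ p ∈ A with p.2 < p.1, f p = R S n := by
    rw [← hlt]
    refine Finset.sum_bij' (fun p _ => p.swap) (fun p _ => p.swap) ?_ ?_ ?_ ?_ ?_ <;>
      simp +contextual [hA, hf, add_comm, mul_comm]
  have heq : ∑ p ∈ A with p.1 = p.2, f p =
      PowerSeries.coeff n (PowerSeries.expand 2 two_ne_zero (indSeries S)) := by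
    rw [PowerSeries.coeff_expand]
    split_ifs with h
    · obtain ⟨k, rfl⟩ := h
      have : (A.filter fun p => p.1 = p.2) = {(k, k)} := by
        ext ⟨a, b⟩
        simp only [hA, Finset.mem_filter, Finset.HasAntidiagonal.mem_antidiagonal,
          Finset.mem_singleton, Prod.mk.injEq]
        omega
      rw [this, Finset.sum_singleton, Nat.mul_div_cancel_left _ two_pos, coeff_indSeries]
      by_cases hk : k ∈ S <;> simp [hf, hk]
    · refine Finset.sum_eq_zero fun p hp => absurd ?_ h
      simp only [hA, Finset.mem_filter, Finset.HasAntidiagonal.mem_antidiagonal] at hp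
      exact ⟨p.1, by omega⟩
  have hsplit : ∑ p ∈ A, f p = ∑ p ∈ A with p.1 < p.2, f p + ∑ p ∈ A with p.2 < p.1, f p
      + ∑ p ∈ A with p.1 = p.2, f p := by
    rw [Finset.sum_filter, Finset.sum_filter, Finset.sum_filter, ← Finset.sum_add_distrib,
      ← Finset.sum_add_distrib]
    refine Finset.sum_congr rfl fun p _ => ?_
    rcases lt_trichotomy p.1 p.2 with h | h | h
    · simp [h, h.ne, h.not_gt]
    · simp [h]
    · simp [h, h.ne', h.not_gt]
  rw [sq, PowerSeries.coeff_mul]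
  simp only [coeff_indSeries]
  rw [← heq, two_mul]
  change ∑ p ∈ A, f p = _
  rw [hsplit, hlt, hgt]

theorem forall_R_eq_iff (C D : Set ℕ) :
    (∀ n, R C n = R D n) ↔ (indSeries C - indSeries D) * (indSeries C + indSeries D) =
      PowerSeries.expand 2 two_ne_zero (indSeries C - indSeries D) := by
  rw [show (indSeries C - indSeries D) * (indSeries C + indSeries D) =
    indSeries C ^ 2 - indSeries D ^ 2 by ring, PowerSeries.ext_iff]
  refine forall_congr' fun n => ?_
  rw [map_sub, map_sub, map_sub, coeff_indSeries_sq, coeff_indSeries_sq]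
  omega

theorem indSeries_AP_mul {r m : ℕ} (hm : 0 < m) :
    indSeries (AP r m) * (1 - PowerSeries.X ^ m) = PowerSeries.X ^ r := by
  classical
  ext n
  rw [mul_sub, mul_one, map_sub, PowerSeries.coeff_mul_X_pow', PowerSeries.coeff_X_pow,
    coeff_indSeries]
  simp only [coeff_indSeries, Set.indicator_apply, Pi.one_apply]
  by_cases h : n ∈ AP r m
  · obtain ⟨k, rfl⟩ := h
    rcases k with _ | k
    · have h1 : m ≤ r → r - m ∉ AP r m := by
        rintro hmr ⟨k, hk⟩
        omega
      have h2 : r ∈ AP r m := ⟨0, by simp⟩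
      by_cases hmr : m ≤ r <;> simp [h1, h2, hmr]
    · have h1 : r + m * (k + 1) ∈ AP r m := ⟨_, rfl⟩
      have h2 : r + m * (k + 1) - m ∈ AP r m := ⟨k, by rw [mul_add]; omega⟩
      have h3 : m ≤ r + m * (k + 1) := by rw [mul_add]; omega
      have h4 : r + m * (k + 1) ≠ r := by rw [mul_add]; omega
      simp only [h1, h2, h3, h4, if_true, if_false, sub_self]
  · have h1 : n ≠ r := fun h' => h ⟨0, by simp [h']⟩
    have h2 : m ≤ n → n - m ∉ AP r m := by
      rintro hmn ⟨k, hk⟩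
      exact h ⟨k + 1, by rw [mul_add]; omega⟩
    by_cases hmn : m ≤ n <;> simp [h, h1, h2, hmn]

theorem indSeries_union_add_inter (A B : Set ℕ) :
    indSeries (A ∪ B) + indSeries (A ∩ B) = indSeries A + indSeries B := by
  ext n
  simp only [map_add, coeff_indSeries]
  exact congrFun (Set.indicator_union_add_inter (1 : ℕ → ℤ) A B) n

theorem indSeries_empty : indSeries ∅ = 0 := by
  ext n
  simp [coeff_indSeries]

theorem indSeries_univ_mul : indSeries Set.univ * (1 - PowerSeries.X) = 1 := by
  have h : AP 0 1 = Set.univ := Set.eq_univ_of_forall fun n => ⟨n, by simp⟩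
  simpa [h] using indSeries_AP_mul (r := 0) one_pos

theorem disjoint_AP {r₁ r₂ m : ℕ} (h₁ : r₁ < m) (h₂ : r₂ < m) (h : r₁ ≠ r₂) :
    Disjoint (AP r₁ m) (AP r₂ m) := by
  rw [Set.disjoint_left]
  rintro n ⟨k, rfl⟩ ⟨l, hl⟩
  have := congrArg (· % m) hl
  simp only [Nat.add_mul_mod_self_left, Nat.mod_eq_of_lt h₁, Nat.mod_eq_of_lt h₂] at this
  exact h this

theorem X_pow_ne_one {m : ℕ} (hm : 0 < m) : (1 - PowerSeries.X ^ m : PowerSeries ℤ) ≠ 0 := by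
  intro h
  simpa [hm.ne'] using congrArg (PowerSeries.coeff (R := ℤ) 0) h

/-- The overlap of a cover of `ℕ` by two sets being a union of two progressions, in terms of
generating functions. -/
theorem indSeries_add_mul {r₁ r₂ m : ℕ} (h₁ : r₁ < r₂) (h₂ : r₂ < m) {C D : Set ℕ}
    (hu : C ∪ D = Set.univ) (hi : C ∩ D = AP r₁ m ∪ AP r₂ m) :
    (indSeries C + indSeries D) * ((1 - PowerSeries.X) * (1 - PowerSeries.X ^ m)) =
      1 - PowerSeries.X ^ m + (1 - PowerSeries.X) *
        (PowerSeries.X ^ r₁ + PowerSeries.X ^ r₂) := by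
  have hAP := indSeries_union_add_inter (AP r₁ m) (AP r₂ m)
  rw [(disjoint_AP (h₁.trans h₂) h₂ h₁.ne).inter_eq, indSeries_empty, add_zero] at hAP
  rw [← indSeries_union_add_inter, hu, hi, hAP]
  have e0 := indSeries_univ_mul
  have e1 := indSeries_AP_mul (r := r₁) (pos_of_gt h₂)
  have e2 := indSeries_AP_mul (r := r₂) (pos_of_gt h₂)
  linear_combination (1 - PowerSeries.X ^ m) * e0 + (1 - PowerSeries.X) * (e1 + e2)

theorem forall_R_eq_iff_of_cover {r₁ r₂ m : ℕ} (h₁ : r₁ < r₂) (h₂ : r₂ < m) {C D : Set ℕ}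
    (hu : C ∪ D = Set.univ) (hi : C ∩ D = AP r₁ m ∪ AP r₂ m) :
    (∀ n, R C n = R D n) ↔ (indSeries C - indSeries D) *
      (1 - PowerSeries.X ^ m + (1 - PowerSeries.X) * (PowerSeries.X ^ r₁ + PowerSeries.X ^ r₂)) =
      PowerSeries.expand 2 two_ne_zero (indSeries C - indSeries D) *
        ((1 - PowerSeries.X) * (1 - PowerSeries.X ^ m)) := by
  have h1 : (1 - PowerSeries.X : PowerSeries ℤ) ≠ 0 := by simpa using X_pow_ne_one one_pos
  rw [forall_R_eq_iff, ← indSeries_add_mul h₁ h₂ hu hi, ← mul_assoc,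
    mul_left_inj' (mul_ne_zero h1 (X_pow_ne_one (pos_of_gt h₂)))]

theorem coeff_expand_two_mul_one_sub_X (T : PowerSeries ℤ) (n : ℕ) :
    PowerSeries.coeff n (PowerSeries.expand 2 two_ne_zero T * (1 - PowerSeries.X)) =
      (-1) ^ n * PowerSeries.coeff (n / 2) T := by
  rw [mul_sub, mul_one, map_sub, PowerSeries.coeff_expand]
  rcases n with _ | n
  · simp
  · rw [PowerSeries.coeff_succ_mul_X, PowerSeries.coeff_expand]
    rcases Nat.even_or_odd' n with ⟨k, rfl | rfl⟩
    · rw [if_neg (by omega), if_pos (by omega), Odd.neg_one_pow (by simp)]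
      rw [show (2 * k + 1) / 2 = 2 * k / 2 by omega]
      ring
    · rw [if_pos (by omega), if_neg (by omega), Even.neg_one_pow (by use k + 1; ring)]
      ring

theorem coeff_recurrence {r₁ r₂ m : ℕ} {T : PowerSeries ℤ}
    (hT : T * (1 - PowerSeries.X ^ m + (1 - PowerSeries.X) *
        (PowerSeries.X ^ r₁ + PowerSeries.X ^ r₂)) =
      PowerSeries.expand 2 two_ne_zero T * ((1 - PowerSeries.X) * (1 - PowerSeries.X ^ m)))
    {n : ℕ} (hn : n < m) :
    PowerSeries.coeff n T = (-1) ^ n * PowerSeries.coeff (n / 2) T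
      - delay (fun k => PowerSeries.coeff k T) r₁ n
      + delay (fun k => PowerSeries.coeff k T) (r₁ + 1) n
      - delay (fun k => PowerSeries.coeff k T) r₂ n
      + delay (fun k => PowerSeries.coeff k T) (r₂ + 1) n := by
  set E := PowerSeries.expand 2 two_ne_zero T with hE
  have hT' : T - T * PowerSeries.X ^ m + T * PowerSeries.X ^ r₁ - T * PowerSeries.X ^ (r₁ + 1)
      + T * PowerSeries.X ^ r₂ - T * PowerSeries.X ^ (r₂ + 1) =
      E * (1 - PowerSeries.X) - E * (1 - PowerSeries.X) * PowerSeries.X ^ m := by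
    linear_combination hT
  have h := congrArg (PowerSeries.coeff n) hT'
  simp only [map_sub, map_add, PowerSeries.coeff_mul_X_pow', if_neg (not_le.mpr hn)] at h
  rw [hE, coeff_expand_two_mul_one_sub_X] at h
  simp only [delay]
  linarith

theorem IsInitialSolution.of_R_eq {r d : ℕ} (hr : 0 < r) (hd : 0 < d) {C D : Set ℕ}
    (hu : C ∪ D = Set.univ) (hi : C ∩ D = AP r (2 * r + d + 1) ∪ AP (r + d) (2 * r + d + 1))
    (hR : ∀ n, R C n = R D n) (h0 : 0 ∉ D) :
    IsInitialSolution r d fun n => PowerSeries.coeff n (indSeries C - indSeries D) := by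
  classical
  have hmem : ∀ n ∈ AP r (2 * r + d + 1) ∪ AP (r + d) (2 * r + d + 1),
      PowerSeries.coeff n (indSeries C - indSeries D) = 0 := by
    intro n hn
    rw [← hi] at hn
    simp [coeff_indSeries, hn.1, hn.2]
  have h0C : 0 ∈ C := ((Set.mem_union ..).mp (hu ▸ Set.mem_univ 0)).resolve_right h0
  refine ⟨?_, fun n => ?_, fun n => ?_, hmem _ (Or.inl ⟨0, by simp⟩),
    hmem _ (Or.inr ⟨0, by simp⟩), fun n hn => ?_⟩
  · simp only [map_sub, coeff_indSeries]
    simp [h0, h0C]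
  · by_cases h1 : n ∈ C <;> by_cases h2 : n ∈ D <;> simp [coeff_indSeries, h1, h2]
  · by_cases h1 : n ∈ C <;> by_cases h2 : n ∈ D <;> simp [coeff_indSeries, h1, h2]
  · exact coeff_recurrence
      ((forall_R_eq_iff_of_cover (by omega) (by omega) hu hi).mp hR) hn

/-- The value at `z` of the complex function with the given integral power series. -/
noncomputable def PowerSeries.complexEval (T : PowerSeries ℤ) (z : ℂ) : ℂ :=
  ∑' n, ((PowerSeries.coeff n T : ℤ) : ℂ) * z ^ n

section DiskEvaluation

open PowerSeries

variable {T : PowerSeries ℤ} {z : ℂ}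

theorem norm_coeff_mul_pow_le (hT : ∀ n, |coeff n T| ≤ 1) (n : ℕ) :
    ‖((coeff n T : ℤ) : ℂ) * z ^ n‖ ≤ ‖z‖ ^ n := by
  have h : ‖((coeff n T : ℤ) : ℂ)‖ ≤ 1 := by
    rw [Complex.norm_intCast]
    exact_mod_cast hT n
  rw [norm_mul, norm_pow]
  exact mul_le_of_le_one_left (by positivity) h

theorem summable_norm_coeff_mul_pow (hT : ∀ n, |coeff n T| ≤ 1) (hz : ‖z‖ < 1) :
    Summable fun n => ‖((coeff n T : ℤ) : ℂ) * z ^ n‖ :=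
  (summable_geometric_of_lt_one (norm_nonneg z) hz).of_nonneg_of_le (fun _ => norm_nonneg _)
    (norm_coeff_mul_pow_le hT)

theorem complexEval_mul {S : PowerSeries ℤ}
    (hT : Summable fun n => ‖((coeff n T : ℤ) : ℂ) * z ^ n‖)
    (hS : Summable fun n => ‖((coeff n S : ℤ) : ℂ) * z ^ n‖) :
    (T * S).complexEval z = T.complexEval z * S.complexEval z := by
  rw [complexEval, complexEval, complexEval,
    tsum_mul_tsum_eq_tsum_sum_antidiagonal_of_summable_norm hT hS]
  refine tsum_congr fun n => ?_
  rw [coeff_mul, Int.cast_sum, Finset.sum_mul]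
  refine Finset.sum_congr rfl fun p hp => ?_
  rw [← Finset.HasAntidiagonal.mem_antidiagonal.mp hp, pow_add, Int.cast_mul]
  ring

theorem coeff_coe_mul_pow_eq_zero (P : Polynomial ℤ) {n : ℕ}
    (hn : n ∉ Finset.range (P.natDegree + 1)) :
    ((coeff n (P : PowerSeries ℤ) : ℤ) : ℂ) * z ^ n = 0 := by
  rw [Polynomial.coeff_coe, Polynomial.coeff_eq_zero_of_natDegree_lt (by simpa using hn)]
  simp

theorem complexEval_coe (P : Polynomial ℤ) :
    (P : PowerSeries ℤ).complexEval z = Polynomial.aeval z P := by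
  rw [complexEval, tsum_eq_sum fun n => coeff_coe_mul_pow_eq_zero P,
    Polynomial.aeval_eq_sum_range]
  simp

theorem summable_norm_coeff_coe_mul_pow (P : Polynomial ℤ) :
    Summable fun n => ‖((coeff n (P : PowerSeries ℤ) : ℤ) : ℂ) * z ^ n‖ :=
  summable_of_ne_finset_zero fun n hn => by rw [coeff_coe_mul_pow_eq_zero P hn, norm_zero]

theorem abs_coeff_expand_le (hT : ∀ n, |coeff n T| ≤ 1) (n : ℕ) :
    |coeff n (expand 2 two_ne_zero T)| ≤ 1 := by
  rw [coeff_expand]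
  split_ifs
  · exact hT _
  · simp

theorem complexEval_expand_two : (expand 2 two_ne_zero T).complexEval z = T.complexEval (z ^ 2) := by
  rw [complexEval, complexEval,
    ← (mul_right_injective₀ (two_ne_zero' ℕ)).tsum_eq 
      (f := fun n => ((coeff n (expand 2 two_ne_zero T) : ℤ) : ℂ) * z ^ n)]
  · simp [pow_mul]
  · intro n hn
    by_contra h
    refine hn ?_
    simp only
    rw [coeff_expand_of_not_dvd, Int.cast_zero, zero_mul]
    rintro ⟨k, rfl⟩
    exact h ⟨k, rfl⟩

theorem complexEval_ne_zero (hT : ∀ n, |coeff n T| ≤ 1) (h0 : coeff 0 T = 1) (hz : ‖z‖ < 1 / 2) :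
    T.complexEval z ≠ 0 := by
  have hs := (summable_norm_coeff_mul_pow hT (hz.trans (by norm_num))).of_norm
  have hgeom := (hasSum_geometric_of_lt_one (norm_nonneg z) (by linarith)).mul_left ‖z‖
  have hbound : ‖∑' n, ((coeff (n + 1) T : ℤ) : ℂ) * z ^ (n + 1)‖ ≤ ‖z‖ * (1 - ‖z‖)⁻¹ :=
    tsum_of_norm_bounded hgeom fun n => by
      simpa [pow_succ'] using norm_coeff_mul_pow_le (z := z) hT (n + 1)
  have hlt : ‖z‖ * (1 - ‖z‖)⁻¹ < 1 := by
    rw [← div_eq_mul_inv, div_lt_one (by linarith)]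
    linarith
  intro h
  rw [complexEval, hs.tsum_eq_zero_add, h0, Int.cast_one, pow_zero, mul_one] at h
  rw [← neg_eq_of_add_eq_zero_right h, norm_neg, norm_one] at hbound
  linarith

theorem one_le_norm_of_isRoot (hT : ∀ n, |coeff n T| ≤ 1) (h0 : coeff 0 T = 1)
    {P : Polynomial ℤ} {m : ℕ} (hm : 0 < m) 
    (h : T * (P : PowerSeries ℤ) = expand 2 two_ne_zero T * (1 - X ^ m))
    (hz : Polynomial.aeval z P = 0) : 1 ≤ ‖z‖ := by
  by_contra! hlt
  have heq : ∀ w : ℂ, ‖w‖ < 1 →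
      T.complexEval w * Polynomial.aeval w P = T.complexEval (w ^ 2) * (1 - w ^ m) := by
    intro w hw
    have hcoe : (1 - X ^ m : PowerSeries ℤ) = ((1 - Polynomial.X ^ m : Polynomial ℤ) :) := by
      simp
    have := congrArg (PowerSeries.complexEval · w) h
    rw [hcoe] at this
    rw [complexEval_mul (summable_norm_coeff_mul_pow hT hw) (summable_norm_coeff_coe_mul_pow P),
      complexEval_mul (summable_norm_coeff_mul_pow (abs_coeff_expand_le hT) hw)
        (summable_norm_coeff_coe_mul_pow _), complexEval_coe, complexEval_coe,
      complexEval_expand_two] at this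
    simpa using this
  have hstep : ∀ w : ℂ, ‖w‖ < 1 → T.complexEval w * Polynomial.aeval w P = 0 →
      T.complexEval (w ^ 2) = 0 := by
    intro w hw hw0
    rw [heq w hw] at hw0
    refine (mul_eq_zero.mp hw0).resolve_right fun h1 => ?_
    have : ‖w ^ m‖ = 1 := by rw [← sub_eq_zero.mp h1, norm_one]
    rw [norm_pow] at this
    exact (pow_lt_one₀ (norm_nonneg w) hw hm.ne').ne this
  have hpow : ∀ k : ℕ, ‖z ^ 2 ^ k‖ < 1 := fun k => by
    rw [norm_pow]
    exact pow_lt_one₀ (norm_nonneg z) hlt (by positivity)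
  have hzero : ∀ k : ℕ, T.complexEval (z ^ 2 ^ (k + 1)) = 0 := by
    intro k
    induction k with
    | zero => simpa using hstep z hlt (by rw [hz, mul_zero])
    | succ k ih =>
      rw [pow_succ 2 (k + 1), pow_mul]
      exact hstep _ (hpow _) (by rw [ih, zero_mul])
  obtain ⟨k, hk⟩ := exists_pow_lt_of_lt_one (by norm_num : (0 : ℝ) < 1 / 2) hlt
  refine complexEval_ne_zero hT h0 ?_ (hzero k)
  rw [norm_pow]
  refine lt_of_le_of_lt (pow_le_pow_of_le_one (norm_nonneg z) hlt.le ?_) hk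
  exact (Nat.lt_two_pow_self.trans (Nat.pow_lt_pow_right (by norm_num) (by omega))).le

end DiskEvaluation

section RootsOnCircle

open Polynomial

theorem Multiset.one_le_norm_prod {s : Multiset ℂ} (hs : ∀ x ∈ s, 1 ≤ ‖x‖) : 1 ≤ ‖s.prod‖ := by
  induction s using Multiset.induction_on with
  | empty => simp
  | cons a s ih =>
    rw [Multiset.prod_cons, norm_mul]
    exact one_le_mul_of_one_le_of_one_le (hs a (by simp)) (ih fun x hx => hs x (by simp [hx]))

theorem norm_eq_one_of_mem_roots {P : ℂ[X]} (hroots : ∀ z ∈ P.roots, 1 ≤ ‖z‖)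
    (h0 : P.coeff 0 = 1) (hl : 1 ≤ ‖P.leadingCoeff‖) {z : ℂ} (hz : z ∈ P.roots) : ‖z‖ = 1 := by
  refine le_antisymm ?_ (hroots z hz)
  have h := (IsAlgClosed.splits P).coeff_zero_eq_leadingCoeff_mul_prod_roots
  have h' := congrArg norm h
  rw [h0, norm_mul, norm_mul, norm_pow, norm_neg, norm_one, one_pow, one_mul,
    ← Multiset.prod_erase hz, norm_mul] at h'
  have he := Multiset.one_le_norm_prod (s := P.roots.erase z) fun x hx =>
    hroots x (Multiset.mem_of_mem_erase hx)
  nlinarith [mul_le_mul hl he zero_le_one (norm_nonneg _), norm_nonneg z]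

theorem re_one_div_one_sub {z : ℂ} (hz : ‖z‖ = 1) (h1 : z ≠ 1) : (1 / (1 - z)).re = 1 / 2 := by
  have hsq : z.re * z.re + z.im * z.im = 1 := by
    rw [← Complex.normSq_apply, Complex.normSq_eq_norm_sq, hz, one_pow]
  have hne : Complex.normSq (1 - z) ≠ 0 := by
    rw [Ne, Complex.normSq_eq_zero, sub_eq_zero]
    exact h1.symm
  rw [one_div, Complex.inv_re, div_eq_iff hne, Complex.normSq_apply]
  simp
  linarith

/-- A polynomial with all its roots on the unit circle, none of them `1`, has logarithmic
derivative of real part half its degree at `1`. -/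
theorem re_logDeriv_one {P : ℂ[X]} (hroots : ∀ z ∈ P.roots, ‖z‖ = 1) (h1 : P.eval 1 ≠ 0) :
    (P.derivative.eval 1 / P.eval 1).re = P.natDegree / 2 := by
  have hs := IsAlgClosed.splits P
  rw [hs.eval_derivative_div_eval_of_ne_zero h1, hs.natDegree_eq_card_roots,
    ← Complex.coe_reAddGroupHom, map_multiset_sum, Multiset.map_map,
    Multiset.map_congr (g := fun _ => (1 / 2 : ℝ)) rfl]
  · simp [div_eq_mul_inv]
  · intro z hz
    refine re_one_div_one_sub (hroots z hz) ?_
    rintro rfl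
    exact h1 (isRoot_of_mem_roots hz)

theorem eq_add_one_of_one_le_norm_roots {r₁ r₂ m : ℕ} (h0 : 0 < r₁) (h₁ : r₁ < r₂) (h₂ : r₂ < m)
    (h : ∀ z : ℂ, aeval z (∑ i ∈ Finset.range m, X ^ i + X ^ r₁ + X ^ r₂ : ℤ[X]) = 0 → 1 ≤ ‖z‖) :
    m = r₁ + r₂ + 1 := by
  set P : ℂ[X] := ∑ i ∈ Finset.range m, X ^ i + X ^ r₁ + X ^ r₂ with hP
  have hcoeff : ∀ n, P.coeff n = (if n < m then 1 else 0) + (if n = r₁ then 1 else 0)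
      + (if n = r₂ then 1 else 0) := by
    intro n
    simp [hP, coeff_X_pow]
  have hlead : 1 ≤ ‖P.coeff (m - 1)‖ := by
    rw [hcoeff, if_pos (by omega), if_neg (by omega)]
    split_ifs <;> norm_num
  have hdeg : P.natDegree = m - 1 := by
    refine natDegree_eq_of_le_of_coeff_ne_zero ?_ (fun h' => ?_)
    · rw [natDegree_le_iff_coeff_eq_zero]
      intro n hn
      rw [hcoeff, if_neg (by omega), if_neg (by omega), if_neg (by omega)]
      simp
    · rw [h', norm_zero] at hlead
      linarith
  have hroots : ∀ z ∈ P.roots, 1 ≤ ‖z‖ := by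
    intro z hz
    refine h z ?_
    have := isRoot_of_mem_roots hz
    simpa [hP, eval_finsetSum, IsRoot.def] using this
  have hcirc : ∀ z ∈ P.roots, ‖z‖ = 1 := fun z hz =>
    norm_eq_one_of_mem_roots hroots
      (by rw [hcoeff, if_pos (by omega), if_neg (by omega), if_neg (by omega)]; simp)
      (by rwa [leadingCoeff, hdeg]) hz
  have he : P.eval 1 = m + 2 := by
    simp [hP, eval_finsetSum]
    ring
  have hm : (m : ℂ) + 2 ≠ 0 := by exact_mod_cast (by omega : m + 2 ≠ 0)
  have hd : P.derivative.eval 1 = ((∑ i ∈ Finset.range m, i : ℕ) + r₁ + r₂ : ℝ) := by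
    simp [hP, eval_finsetSum, derivative_X_pow]
  have key := re_logDeriv_one hcirc (by rwa [he])
  have hm' : (m : ℂ) + 2 = ((m + 2 : ℝ) : ℂ) := by push_cast; ring
  rw [he, hd, hdeg, hm', ← Complex.ofReal_div, Complex.ofReal_re,
    div_eq_div_iff (by positivity) two_ne_zero] at key
  have hsum := Finset.sum_range_id_mul_two m
  obtain ⟨k, rfl⟩ : ∃ k, m = k + 1 := ⟨m - 1, by omega⟩
  rw [Nat.add_sub_cancel] at *
  have hsum' : ((∑ i ∈ Finset.range (k + 1), i : ℕ) : ℝ) * 2 = (k + 1) * k := by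
    exact_mod_cast hsum
  have : (k : ℝ) = r₁ + r₂ := by
    push_cast at *
    linarith
  have : k = r₁ + r₂ := by exact_mod_cast this
  omega

end RootsOnCircle

theorem one_sub_X_pow_add_eq (r₁ r₂ m : ℕ) :
    (1 - PowerSeries.X ^ m + (1 - PowerSeries.X) * (PowerSeries.X ^ r₁ + PowerSeries.X ^ r₂) :
      PowerSeries ℤ) =
    (1 - PowerSeries.X) * ((∑ i ∈ Finset.range m, Polynomial.X ^ i + Polynomial.X ^ r₁ +
      Polynomial.X ^ r₂ : Polynomial ℤ) : PowerSeries ℤ) := by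
  have h : (∑ i ∈ Finset.range m, (Polynomial.X : Polynomial ℤ) ^ i) * (1 - Polynomial.X) =
      1 - Polynomial.X ^ m := geom_sum_mul_neg _ _
  have h' := congrArg (fun P : Polynomial ℤ => (P : PowerSeries ℤ)) h
  simp only [Polynomial.coe_mul, Polynomial.coe_sub, Polynomial.coe_one, Polynomial.coe_X,
    Polynomial.coe_pow] at h'
  simp only [Polynomial.coe_add, Polynomial.coe_X, Polynomial.coe_pow]
  linear_combination -h'

theorem eq_add_one_of_R_eq {r₁ r₂ m : ℕ} (h₁ : 0 < r₁) (h₂ : r₁ < r₂) (h₃ : r₂ < m) {C D : Set ℕ}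
    (hu : C ∪ D = Set.univ) (hi : C ∩ D = AP r₁ m ∪ AP r₂ m) (hR : ∀ n, R C n = R D n)
    (h0 : 0 ∉ D) : m = r₁ + r₂ + 1 := by
  classical
  have h0C : 0 ∈ C := ((Set.mem_union ..).mp (hu ▸ Set.mem_univ 0)).resolve_right h0
  have h := (forall_R_eq_iff_of_cover h₂ h₃ hu hi).mp hR
  rw [one_sub_X_pow_add_eq, mul_left_comm,
    mul_left_comm _ (1 - PowerSeries.X) (1 - PowerSeries.X ^ m)] at h
  have hX : (1 - PowerSeries.X : PowerSeries ℤ) ≠ 0 := by simpa using X_pow_ne_one one_pos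
  refine eq_add_one_of_one_le_norm_roots h₁ h₂ h₃ fun z hz =>
    one_le_norm_of_isRoot (fun n => ?_) ?_ (by omega) (mul_left_cancel₀ hX h) hz
  · by_cases h1 : n ∈ C <;> by_cases h2 : n ∈ D <;> simp [coeff_indSeries, h1, h2]
  · rw [map_sub, coeff_indSeries, coeff_indSeries]
    simp [h0, h0C]

theorem exists_two_pow_of_R_eq {r₁ r₂ m : ℕ} (h₁ : 0 < r₁) (h₂ : r₁ < r₂) (h₃ : r₂ < m)
    (h₄ : Even r₁) {C D : Set ℕ} (hu : C ∪ D = Set.univ) (hi : C ∩ D = AP r₁ m ∪ AP r₂ m)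
    (hR : ∀ n, R C n = R D n) (h0 : 0 ∉ D) :
    ∃ l : ℕ, 0 < l ∧ r₁ = 2 ^ (2 * l + 1) - 2 ∧ r₂ = 2 ^ (2 * l + 1) - 1 ∧
      m = 2 ^ (2 * l + 2) - 2 := by
  have hm := eq_add_one_of_R_eq h₁ h₂ h₃ hu hi hR h0
  obtain ⟨d, rfl⟩ := Nat.exists_eq_add_of_lt h₂
  obtain rfl : m = 2 * r₁ + (d + 1) + 1 := by omega
  have hsol := IsInitialSolution.of_R_eq h₁ d.succ_pos hu hi hR h0
  obtain rfl : d = 0 := Nat.succ_injective (hsol.gap_eq_one h₁ h₄ d.succ_pos)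
  obtain ⟨l, hl, hr⟩ := hsol.exists_two_pow h₁ h₄
  have : 2 ^ (2 * l + 2) = 2 * 2 ^ (2 * l + 1) := by ring
  exact ⟨l, hl, hr, by omega, by omega⟩

theorem zero_notMem_AP {r m : ℕ} (hr : 0 < r) : 0 ∉ AP r m := by
  rintro ⟨k, hk⟩
  omega

theorem mem_AP_iff {r m n : ℕ} (hr : r < m) : n ∈ AP r m ↔ n % m = r := by
  refine ⟨?_, fun h => ⟨n / m, ?_⟩⟩
  · rintro ⟨k, rfl⟩
    rw [Nat.add_mul_mod_self_left, Nat.mod_eq_of_lt hr]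
  · rw [← h, Nat.mod_add_div]

theorem exists_indSeries_sub_eq {T : PowerSeries ℤ} (hT : ∀ n, |PowerSeries.coeff n T| ≤ 1) :
    ∃ C D : Set ℕ, C ∪ D = Set.univ ∧ C ∩ D = {n | PowerSeries.coeff n T = 0} ∧
      indSeries C - indSeries D = T := by
  classical
  refine ⟨{n | 0 ≤ PowerSeries.coeff n T}, {n | PowerSeries.coeff n T ≤ 0}, ?_, ?_, ?_⟩
  · exact Set.eq_univ_of_forall fun n =>
      le_total 0 (PowerSeries.coeff n T)
  · ext n
    simp [le_antisymm_iff, and_comm]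
  · ext n
    have := abs_le.mp (hT n)
    simp only [map_sub, coeff_indSeries, Set.indicator_apply, Set.mem_ofPred_eq, Pi.one_apply]
    split_ifs <;> omega

theorem coeff_mul_expand {m : ℕ} (hm : m ≠ 0) {U : PowerSeries ℤ}
    (hU : ∀ n, m ≤ n → PowerSeries.coeff n U = 0) (F : PowerSeries ℤ) (n : ℕ) :
    PowerSeries.coeff n (U * PowerSeries.expand m hm F) =
      PowerSeries.coeff (n % m) U * PowerSeries.coeff (n / m) F := by
  rw [PowerSeries.coeff_mul, Finset.sum_eq_single (n % m, m * (n / m))]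
  · rw [PowerSeries.coeff_expand_mul]
  · rintro ⟨i, j⟩ hp hne
    rw [Finset.HasAntidiagonal.mem_antidiagonal] at hp
    simp only at hp ⊢
    rcases le_or_gt m i with h | h
    · rw [hU i h, zero_mul]
    · rw [PowerSeries.coeff_expand_of_not_dvd, mul_zero]
      rintro ⟨k, rfl⟩
      rw [← hp, Nat.add_mul_mod_self_left, Nat.mod_eq_of_lt h,
        Nat.add_mul_div_left _ _ (Nat.pos_of_ne_zero hm), Nat.div_eq_of_lt h, zero_add] at hne
      exact hne rfl
  · intro h
    rw [Finset.HasAntidiagonal.mem_antidiagonal] at h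
    exact absurd (Nat.mod_add_div n m) h

/-- The generating function of the Thue–Morse sequence. -/
noncomputable def thueMorseSeries : PowerSeries ℤ := PowerSeries.mk thueMorse

/-- The generating function of the first `2 ^ k` terms of the Thue–Morse sequence. -/
noncomputable def thueMorseBlock (k : ℕ) : PowerSeries ℤ :=
  PowerSeries.mk fun n => if n < 2 ^ k then thueMorse n else 0

theorem thueMorseSeries_eq :
    thueMorseSeries = PowerSeries.expand 2 two_ne_zero thueMorseSeries * (1 - PowerSeries.X) := by
  ext n
  rw [coeff_expand_two_mul_one_sub_X, thueMorseSeries, PowerSeries.coeff_mk, PowerSeries.coeff_mk,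
    thueMorse_eq_sign_mul]

theorem expand_thueMorseSeries {p : ℕ} (hp : p ≠ 0) :
    PowerSeries.expand p hp thueMorseSeries = PowerSeries.expand 2 two_ne_zero
      (PowerSeries.expand p hp thueMorseSeries) * (1 - PowerSeries.X ^ p) := by
  conv_lhs => rw [thueMorseSeries_eq]
  rw [map_mul, map_sub, map_one, PowerSeries.expand_X, ← PowerSeries.expand_mul,
    ← PowerSeries.expand_mul]
  simp only [mul_comm]

theorem thueMorseSeries_eq_block_mul (k : ℕ) :
    thueMorseSeries = thueMorseBlock k *
      PowerSeries.expand (2 ^ k) (by positivity) thueMorseSeries := by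
  ext n
  have hlt : n % 2 ^ k < 2 ^ k := Nat.mod_lt _ (by positivity)
  rw [coeff_mul_expand, thueMorseSeries, thueMorseBlock, PowerSeries.coeff_mk,
    PowerSeries.coeff_mk, PowerSeries.coeff_mk, if_pos hlt, mul_comm,
    ← thueMorse_two_pow_mul_add k _ hlt, Nat.div_add_mod]
  intro n hn
  rw [thueMorseBlock, PowerSeries.coeff_mk, if_neg hn.not_gt]

theorem thueMorseBlock_mul (k : ℕ) :
    thueMorseBlock k * (1 - PowerSeries.X ^ 2 ^ k) =
      PowerSeries.expand 2 two_ne_zero (thueMorseBlock k) * (1 - PowerSeries.X) := by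
  have hk : 2 ^ k ≠ 0 := by positivity
  set G := PowerSeries.expand 2 two_ne_zero (PowerSeries.expand (2 ^ k) hk thueMorseSeries) with hG
  have hG0 : G ≠ 0 := by
    intro h
    have := congrArg (PowerSeries.coeff 0) h
    simp [hG, PowerSeries.coeff_expand, thueMorseSeries, thueMorse_zero] at this
  refine mul_right_cancel₀ hG0 ?_
  have hB := thueMorseSeries_eq_block_mul k
  have hE := congrArg (PowerSeries.expand 2 two_ne_zero) hB
  rw [map_mul, ← hG] at hE
  have hF := expand_thueMorseSeries hk
  rw [← hG] at hF
  linear_combination -thueMorseBlock k * hF - hB + thueMorseSeries_eq + (1 - PowerSeries.X) * hE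

/-- Generating function of `χ_C - χ_D` for the extremal pair `C`, `D`. -/
noncomputable def extremalSeries (k p m : ℕ) (hm : m ≠ 0) : PowerSeries ℤ :=
  thueMorseBlock k * (1 - PowerSeries.X ^ p) * PowerSeries.expand m hm thueMorseSeries

theorem extremalSeries_mul {k p m : ℕ} (hm : m ≠ 0) :
    extremalSeries k p m hm * ((1 + PowerSeries.X ^ p) * (1 - PowerSeries.X ^ 2 ^ k)) =
      PowerSeries.expand 2 two_ne_zero (extremalSeries k p m hm) *
        ((1 - PowerSeries.X) * (1 - PowerSeries.X ^ m)) := by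
  have h1 := thueMorseBlock_mul k
  have h2 := expand_thueMorseSeries hm
  rw [extremalSeries]
  simp only [map_mul, map_sub, map_one, map_pow, PowerSeries.expand_X]
  linear_combination (1 - PowerSeries.X ^ p) * (1 + PowerSeries.X ^ p) *
      PowerSeries.expand m hm thueMorseSeries * h1 +
    PowerSeries.expand 2 two_ne_zero (thueMorseBlock k) * (1 - PowerSeries.X) *
      (1 - PowerSeries.X ^ (2 * p)) * h2

theorem coeff_extremalSeries {k p m : ℕ} (hk : Odd k) (hp : p + 2 = 2 ^ k)
    (hm : m = 2 * p + 2) (hm0 : m ≠ 0) (n : ℕ) :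
    |PowerSeries.coeff n (extremalSeries k p m hm0)| ≤ 1 ∧
    (PowerSeries.coeff n (extremalSeries k p m hm0) = 0 ↔ n ∈ AP p m ∪ AP (p + 1) m) := by
  have hcoeff : ∀ i, PowerSeries.coeff i (thueMorseBlock k * (1 - PowerSeries.X ^ p)) =
      (if i < p + 2 then thueMorse i else 0) -
        if p ≤ i then if i - p < p + 2 then thueMorse (i - p) else 0 else 0 := by
    intro i
    rw [mul_sub, mul_one, map_sub, PowerSeries.coeff_mul_X_pow', thueMorseBlock,
      PowerSeries.coeff_mk, PowerSeries.coeff_mk, hp]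
  have hep : thueMorse p = 1 := by
    obtain ⟨j, rfl⟩ := hk
    have : p = 2 * (2 ^ (2 * j) - 1) := by
      rw [pow_succ] at hp
      omega
    rw [this, thueMorse_two_mul, thueMorse_two_pow_sub_one, pow_mul]
    simp
  have hpe : Even p := by
    obtain ⟨j, rfl⟩ := hk
    rw [pow_succ] at hp
    exact ⟨2 ^ (2 * j) - 1, by omega⟩
  have hep1 : thueMorse (p + 1) = -1 := by rw [thueMorse_add_one_of_even hpe, hep]
  rw [extremalSeries, coeff_mul_expand hm0, Set.mem_union, mem_AP_iff (by omega),
    mem_AP_iff (by omega), hcoeff, thueMorseSeries, PowerSeries.coeff_mk]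
  · have hlt : n % m < m := Nat.mod_lt _ (by omega)
    revert hlt
    generalize n % m = i
    intro hlt
    have hq : |thueMorse (n / m)| = 1 ∧ thueMorse (n / m) ≠ 0 := by
      rcases thueMorse_eq_one_or (n / m) with h | h <;> simp [h]
    rw [abs_mul, hq.1, mul_one, mul_eq_zero, or_iff_left hq.2]
    by_cases h1 : i = p
    · subst h1
      simp [hep, thueMorse_zero]
    by_cases h2 : i = p + 1
    · subst h2
      simp [hep1, thueMorse_one]
    rcases thueMorse_eq_one_or i with ha | ha <;> rcases thueMorse_eq_one_or (i - p) with hb | hb <;>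
      rw [ha, hb] <;> split_ifs <;> simp <;> omega
  · intro i hi
    rw [hcoeff, if_neg (by omega), if_pos (by omega), if_neg (by omega), sub_zero]

theorem exists_R_eq (l : ℕ) {r₁ r₂ m : ℕ} (h₁ : r₁ = 2 ^ (2 * l + 1) - 2)
    (h₂ : r₂ = 2 ^ (2 * l + 1) - 1) (h₃ : m = 2 ^ (2 * l + 2) - 2) :
    ∃ C D : Set ℕ, C ∪ D = Set.univ ∧ C ∩ D = AP r₁ m ∪ AP r₂ m ∧ ∀ n : ℕ, R C n = R D n := by
  have hpow : 2 ^ (2 * l + 2) = 2 * 2 ^ (2 * l + 1) := by ring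
  have hpos : 2 ≤ 2 ^ (2 * l + 1) := Nat.le_self_pow (by omega) 2
  obtain rfl : r₂ = r₁ + 1 := by omega
  have hm : m = 2 * r₁ + 2 := by omega
  have hm0 : m ≠ 0 := by omega
  have hp : r₁ + 2 = 2 ^ (2 * l + 1) := by omega
  have key := coeff_extremalSeries (k := 2 * l + 1) ⟨l, rfl⟩ hp hm hm0
  obtain ⟨C, D, hu, hi, hCD⟩ := exists_indSeries_sub_eq fun n => (key n).1
  have hi' : C ∩ D = AP r₁ m ∪ AP (r₁ + 1) m := hi.trans (Set.ext fun n => (key n).2)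
  refine ⟨C, D, hu, hi', (forall_R_eq_iff_of_cover (by omega) (by omega) hu hi').mpr ?_⟩
  rw [hCD, ← extremalSeries_mul, ← hp]
  have hX : (PowerSeries.X ^ m : PowerSeries ℤ) = PowerSeries.X ^ (2 * r₁ + 2) := by rw [hm]
  rw [hX]
  ring

theorem stmt_0 (r₁ r₂ m : ℕ) (h₁ : 0 < r₁) (h₂ : r₁ < r₂) (h₃ : r₂ < m)
    (h₄ : Even r₁) :
    (∃ C D : Set ℕ, C ∪ D = Set.univ ∧ C ∩ D = AP r₁ m ∪ AP r₂ m ∧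
      ∀ n : ℕ, R C n = R D n) ↔
    ∃ l : ℕ, 0 < l ∧ r₁ = 2 ^ (2 * l + 1) - 2 ∧ r₂ = 2 ^ (2 * l + 1) - 1 ∧
      m = 2 ^ (2 * l + 2) - 2 := by
  constructor
  · rintro ⟨C, D, hu, hi, hR⟩
    by_cases h0 : 0 ∈ D
    · refine exists_two_pow_of_R_eq h₁ h₂ h₃ h₄ (Set.union_comm C D ▸ hu)
        (Set.inter_comm C D ▸ hi) (fun n => (hR n).symm) fun h0C => ?_
      have : 0 ∈ AP r₁ m ∪ AP r₂ m := hi ▸ ⟨h0C, h0⟩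
      exact this.elim (zero_notMem_AP h₁) (zero_notMem_AP (h₁.trans h₂))
    · exact exists_two_pow_of_R_eq h₁ h₂ h₃ h₄ hu hi hR h0
  · rintro ⟨l, -, hr₁, hr₂, hm⟩
    exact exists_R_eq l hr₁ hr₂ hm
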